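/- Let A be a finite abelian group with invariant factor decomposition A ≅ (Z/2Z)^a ⊕ Z_{d_{a+1}} ⊕ ... ⊕ Z_{d_{a+b}}, where each d_i > 2 for i > a and divisibility d_{a+1} | ... | d_{a+b} holds. Then the minimal dimension of a faithful real representation of A equals a + 2b. -/

import Mathlib

open Matrix in
/-- The characters occurring in a complex matrix representation of an abelian group. -/
def IsWeight {A : Type*} [AddCommGroup A] {n : ℕ}
    (M : Multiplicative A →* Matrix (Fin n) (Fin n) ℂ) (ψ : AddChar A ℂ) : Prop :=
  ∃ v : Fin n → ℂ, v ≠ 0 ∧ ∀ g, M (.ofAdd g) *ᵥ v = ψ g • v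

lemma AddChar.sum_neg_mul {A : Type*} [AddCommGroup A] [Fintype A] [DecidableEq (AddChar A ℂ)]
    (ψ χ : AddChar A ℂ) :
    ∑ g, ψ (-g) * χ g = if χ = ψ then (Fintype.card A : ℂ) else 0 := by
  have h := AddChar.sum_eq_ite (ψ⁻¹ * χ)
  simp only [AddChar.mul_apply, AddChar.inv_apply] at h
  rw [h]
  congr 1
  rw [eq_iff_iff, ← AddChar.one_eq_zero, inv_mul_eq_one, eq_comm]

open Matrix in
lemma card_le_of_isWeight {A : Type*} [AddCommGroup A] [Fintype A] {n : ℕ}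
    (M : Multiplicative A →* Matrix (Fin n) (Fin n) ℂ) (S : Finset (AddChar A ℂ))
    (hS : ∀ ψ ∈ S, IsWeight M ψ) : S.card ≤ n := by
  classical
  choose v hv hM using fun ψ : S => hS ψ.1 ψ.2
  have hli : LinearIndependent ℂ v := by
    rw [Fintype.linearIndependent_iff]
    intro c hc ψ
    have h : ∑ χ : S, c χ • (∑ g, (ψ.1 (-g) * χ.1 g)) • v χ = 0 := by
      calc _ = ∑ g, ψ.1 (-g) • M (.ofAdd g) *ᵥ (∑ χ : S, c χ • v χ) := by
            simp only [Matrix.mulVec_sum, Matrix.mulVec_smul, hM, Finset.smul_sum, Finset.sum_smul]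
            rw [Finset.sum_comm]
            refine Finset.sum_congr rfl fun g _ => Finset.sum_congr rfl fun χ _ => ?_
            simp only [smul_smul]
            congr 1
            ring
        _ = 0 := by rw [hc]; simp
    simp only [AddChar.sum_neg_mul] at h
    rw [Finset.sum_eq_single ψ] at h
    · simpa [hv] using h
    · intro χ _ hne
      rw [if_neg (fun h => hne (Subtype.ext h))]
      simp
    · simp
  simpa using hli.fintype_card_le_finrank

open Matrix in
lemma eq_one_of_isWeight {A : Type*} [AddCommGroup A] [Fintype A] {n : ℕ}
    (M : Multiplicative A →* Matrix (Fin n) (Fin n) ℂ) (x : A)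
    (hx : ∀ ψ, IsWeight M ψ → ψ x = 1) : M (.ofAdd x) = 1 := by
  classical
  let P (ψ : AddChar A ℂ) : Matrix (Fin n) (Fin n) ℂ := ∑ g, ψ (-g) • M (.ofAdd g)
  have hmul (ψ : AddChar A ℂ) (y : A) : M (.ofAdd y) * P ψ = ψ y • P ψ := by
    simp only [P, Finset.mul_sum, Finset.smul_sum, Matrix.mul_smul, ← map_mul, ← ofAdd_add,
      smul_smul, ← AddChar.map_add_eq_mul]
    exact Fintype.sum_equiv (Equiv.addLeft y) _ _ fun g => by simp
  have hfix (ψ : AddChar A ℂ) (w : Fin n → ℂ) :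
      M (.ofAdd x) *ᵥ (P ψ *ᵥ w) = P ψ *ᵥ w := by
    by_cases h0 : P ψ *ᵥ w = 0
    · simp [h0]
    · have hψ : IsWeight M ψ := ⟨P ψ *ᵥ w, h0, fun g => by
        rw [Matrix.mulVec_mulVec, hmul, Matrix.smul_mulVec]⟩
      rw [Matrix.mulVec_mulVec, hmul, hx ψ hψ, one_smul]
  have hsum : ∑ ψ, P ψ = (Fintype.card A : ℂ) • 1 := by
    simp only [P]
    rw [Finset.sum_comm]
    simp only [← Finset.sum_smul, AddChar.sum_apply_eq_ite]
    rw [Finset.sum_eq_single 0]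
    · simp
    · intro g _ hg
      simp [hg]
    · simp
  have hcard : (Fintype.card A : ℂ) ≠ 0 := Nat.cast_ne_zero.2 Fintype.card_ne_zero
  refine smul_right_injective _ hcard (Matrix.mulVec_injective (funext fun w => ?_))
  have h1 : M (.ofAdd x) *ᵥ ((∑ ψ, P ψ) *ᵥ w) = (∑ ψ, P ψ) *ᵥ w := by
    simp only [Matrix.sum_mulVec, Matrix.mulVec_sum, hfix]
  rw [hsum] at h1
  simpa [Matrix.smul_mulVec, Matrix.mulVec_smul] using h1

lemma AddChar.card_le_pow_of_separates {A κ : Type*} [AddCommGroup A] [Fintype κ] {p : ℕ}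
    (hp : 0 < p) (φ : κ → A) (hφ : ∀ k, p • φ k = 0) (U : Finset (AddChar A ℂ))
    (hU : ∀ k l, (∀ ψ ∈ U, ψ (φ k) = ψ (φ l)) → k = l) : Fintype.card κ ≤ p ^ U.card := by
  classical
  have : NeZero p := ⟨hp.ne'⟩
  let F (k : κ) (ψ : U) : Polynomial.nthRootsFinset p (1 : ℂ) :=
    ⟨ψ.1 (φ k), (Polynomial.mem_nthRootsFinset hp _).2 (by
      rw [← AddChar.map_nsmul_eq_pow, hφ, AddChar.map_zero_eq_one])⟩
  have hF : Function.Injective F := fun k l h => hU k l fun ψ hψ =>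
    congrArg Subtype.val (congrFun h ⟨ψ, hψ⟩)
  refine (Fintype.card_le_of_injective F hF).trans ?_
  rw [Fintype.card_fun, Fintype.card_coe, Fintype.card_coe]
  exact Nat.pow_le_pow_left
    ((Multiset.toFinset_card_le _).trans (Polynomial.card_nthRoots p (1 : ℂ))) _

/-- A set of characters closed under inversion is the disjoint union of a set `R` of characters
of order at most two, a set `T` and the inverse of `T`. -/
lemma AddChar.exists_half {A : Type*} [AddCommGroup A] [Finite A] (S : Finset (AddChar A ℂ))
    (hS : ∀ ψ ∈ S, ψ⁻¹ ∈ S) : ∃ R T : Finset (AddChar A ℂ), R.card + 2 * T.card = S.card ∧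
      (∀ ψ ∈ R, ψ⁻¹ = ψ) ∧ ∀ ψ ∈ S, ψ ∈ R ∨ ψ ∈ T ∨ ψ⁻¹ ∈ T := by
  classical
  let e := Fintype.equivFin (AddChar A ℂ)
  let R := S.filter fun ψ => ψ⁻¹ = ψ
  let T := S.filter fun ψ => e ψ < e ψ⁻¹
  let T' := S.filter fun ψ => e ψ⁻¹ < e ψ
  have hTT' : T.card = T'.card := Finset.card_bij' (fun ψ _ => ψ⁻¹) (fun ψ _ => ψ⁻¹)
    (by simp +contextual [T, T', hS]) (by simp +contextual [T, T', hS]) (by simp) (by simp)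
  have hcases (ψ : AddChar A ℂ) : ψ⁻¹ = ψ ∨ e ψ < e ψ⁻¹ ∨ e ψ⁻¹ < e ψ := by
    rcases lt_trichotomy (e ψ) (e ψ⁻¹) with h | h | h
    · exact .inr (.inl h)
    · exact .inl (e.injective h).symm
    · exact .inr (.inr h)
  have hunion : S = R ∪ (T ∪ T') := by
    ext ψ
    have := hcases ψ
    simp only [R, T, T', Finset.mem_union, Finset.mem_filter]
    tauto
  refine ⟨R, T, ?_, fun ψ hψ => (Finset.mem_filter.1 hψ).2, fun ψ hψ => ?_⟩
  · have h1 : Disjoint T T' := Finset.disjoint_filter.2 fun ψ _ h => h.not_gt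
    have h2 : Disjoint R (T ∪ T') := by
      rw [Finset.disjoint_left]
      intro ψ hR hT
      simp only [R, T, T', Finset.mem_union, Finset.mem_filter] at hR hT
      rw [hR.2] at hT
      simp at hT
    rw [hunion, Finset.card_union_of_disjoint h2, Finset.card_union_of_disjoint h1, ← hTT']
    ring
  · have := hcases ψ
    have := hS ψ hψ
    simp only [R, T, Finset.mem_filter, inv_inv]
    tauto

open Matrix in
/-- A faithful real representation of dimension `n` yields a set `R` of real characters
and a set `T` of characters that together separate points, with `R.card + 2 * T.card ≤ n`. -/
lemma exists_separating_addChar {A : Type*} [AddCommGroup A] [Fintype A] {n : ℕ}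
    (ρ : Multiplicative A →* GL (Fin n) ℝ) (hρ : Function.Injective ρ) :
    ∃ R T : Finset (AddChar A ℂ), R.card + 2 * T.card ≤ n ∧ (∀ ψ ∈ R, ψ⁻¹ = ψ) ∧
      ∀ x y, (∀ ψ ∈ R, ψ x = ψ y) → (∀ ψ ∈ T, ψ x = ψ y) → x = y := by
  classical
  let M : Multiplicative A →* Matrix (Fin n) (Fin n) ℂ :=
    ((Complex.ofRealHom.mapMatrix : Matrix (Fin n) (Fin n) ℝ →+* _) : _ →* _).comp
      ((Units.coeHom _).comp ρ)
  have hM (x : A) : M (.ofAdd x) = (ρ (.ofAdd x)).1.map Complex.ofReal := rfl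
  let S : Finset (AddChar A ℂ) := Finset.univ.filter (IsWeight M)
  have hS : ∀ ψ ∈ S, ψ⁻¹ ∈ S := by
    simp only [S, Finset.mem_filter, Finset.mem_univ, true_and]
    rintro ψ ⟨v, hv, hψ⟩
    refine ⟨star v, star_ne_zero.2 hv, fun g => ?_⟩
    have h := congrArg star (hψ g)
    rw [AddChar.inv_apply, AddChar.map_neg_eq_conj]
    refine Eq.trans ?_ (h.trans (by ext; simp))
    ext i
    simp [hM, Matrix.mulVec, dotProduct]
  obtain ⟨R, T, hcard, hR, hRT⟩ := AddChar.exists_half S hS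
  refine ⟨R, T, hcard.trans_le (card_le_of_isWeight M S fun ψ hψ => (Finset.mem_filter.1 hψ).2),
    hR, fun x y hxR hxT => ?_⟩
  have hone : M (.ofAdd (x - y)) = 1 := eq_one_of_isWeight M _ fun ψ hψ => by
    have hxy : ψ x = ψ y := by
      rcases hRT ψ (by simpa [S] using hψ) with h | h | h
      · exact hxR ψ h
      · exact hxT ψ h
      · have := hxT _ h
        rwa [AddChar.inv_apply, AddChar.inv_apply, AddChar.map_neg_eq_inv, AddChar.map_neg_eq_inv,
          _root_.inv_inj] at this
    rw [AddChar.map_sub_eq_div, hxy, div_self (ψ.val_isUnit y).ne_zero]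
  have hρ1 : ρ (.ofAdd (x - y)) = 1 := by
    refine Units.ext (Matrix.map_injective Complex.ofReal_injective ?_)
    exact (hM _).symm.trans (hone.trans (by simp))
  rw [← map_one ρ] at hρ1
  exact sub_eq_zero.1 (Multiplicative.ofAdd.injective (hρ hρ1))

lemma ZMod.injective_natCast_mul_div {m q : ℕ} (hm : m ≠ 0) (hq : q ∣ m) :
    Function.Injective fun k : Fin q => ((k * (m / q) : ℕ) : ZMod m) := by
  obtain ⟨c, rfl⟩ := hq
  have hq0 : 0 < q := Nat.pos_of_ne_zero (by rintro rfl; simp at hm)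
  have hc : 0 < c := Nat.pos_of_ne_zero (by rintro rfl; simp at hm)
  intro k l h
  simp only [Nat.mul_div_cancel_left c hq0] at h
  have h := (ZMod.natCast_eq_natCast_iff' _ _ _).1 h
  rw [Nat.mod_eq_of_lt (Nat.mul_lt_mul_of_pos_right k.2 hc),
    Nat.mod_eq_of_lt (Nat.mul_lt_mul_of_pos_right l.2 hc)] at h
  exact Fin.ext (Nat.eq_of_mul_eq_mul_right hc h)

lemma ZMod.nsmul_natCast_mul_div {m q : ℕ} (hq : q ∣ m) (k : ℕ) :
    q • ((k * (m / q) : ℕ) : ZMod m) = 0 := by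
  rw [nsmul_eq_mul, ← Nat.cast_mul, mul_left_comm, Nat.mul_div_cancel' hq]
  simp

/-- If the `d i > 2` form a divisibility chain, then `2 * ∏ ZMod (d i)` contains `(ZMod p) ^ b`
for some `p > 1`. -/
lemma exists_torsion_divisible_by_two {b : ℕ} (d : Fin b → ℕ) (hd : ∀ i, 2 < d i)
    (hdvd : ∀ i j : Fin b, i ≤ j → d i ∣ d j) :
    ∃ p, 1 < p ∧ ∃ φ ψ : (Fin b → Fin p) → ∀ i, ZMod (d i), Function.Injective φ ∧
      ∀ k, p • φ k = 0 ∧ φ k = 2 • ψ k := by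
  rcases Nat.eq_zero_or_pos b with rfl | hb
  · exact ⟨2, one_lt_two, fun _ => 0, fun _ => 0, fun _ _ _ => Subsingleton.elim _ _, by simp⟩
  have hinj {p : ℕ} (hp : ∀ i, p ∣ d i) : Function.Injective
      fun (k : Fin b → Fin p) i => ((k i * (d i / p) : ℕ) : ZMod (d i)) := fun k l h =>
    funext fun i => ZMod.injective_natCast_mul_div (by have := hd i; omega) (hp i) (congrFun h i)
  rcases Nat.four_dvd_or_exists_odd_prime_and_dvd_of_two_lt (hd ⟨0, hb⟩) with h | ⟨p, hp, h, hodd⟩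
  · have h4 i : 4 ∣ d i := h.trans (hdvd _ i (Nat.zero_le _))
    have h2 i : 2 ∣ d i := (by norm_num : 2 ∣ 4).trans (h4 i)
    refine ⟨2, one_lt_two, _, fun k i => ((k i * (d i / 4) : ℕ) : ZMod (d i)), hinj h2, fun k =>
      ⟨funext fun i => ZMod.nsmul_natCast_mul_div (h2 i) _, funext fun i => ?_⟩⟩
    have : d i / 2 = 2 * (d i / 4) := by have := h4 i; omega
    simp only [Pi.smul_apply, nsmul_eq_mul, this]
    push_cast
    ring
  · have hpd i : p ∣ d i := h.trans (hdvd _ i (Nat.zero_le _))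
    obtain ⟨c, hc⟩ := hodd
    refine ⟨p, hp.one_lt, _, fun k i => (c + 1) • ((k i * (d i / p) : ℕ) : ZMod (d i)), hinj hpd,
      fun k => ⟨funext fun i => ZMod.nsmul_natCast_mul_div (hpd i) _, funext fun i => ?_⟩⟩
    have h0 := ZMod.nsmul_natCast_mul_div (hpd i) (k i)
    simp only [Pi.smul_apply, smul_smul]
    rw [show 2 * (c + 1) = p + 1 by omega, add_smul, h0, zero_add, one_smul]

lemma le_of_faithful_real {a b : ℕ} {d : Fin b → ℕ}
    (hd : ∀ i, 2 < d i) (hdvd : ∀ i j : Fin b, i ≤ j → d i ∣ d j)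
    (hdvd2 : 0 < a → ∀ i, 2 ∣ d i) {n : ℕ}
    (ρ : Multiplicative ((Fin a → ZMod 2) × (∀ i : Fin b, ZMod (d i))) →* GL (Fin n) ℝ)
    (hρ : Function.Injective ρ) : a + 2 * b ≤ n := by
  classical
  have (i : Fin b) : NeZero (d i) := ⟨by have := hd i; omega⟩
  obtain ⟨R, T, hcard, hR, hsep⟩ := exists_separating_addChar ρ hρ
  have hb : b ≤ T.card := by
    obtain ⟨p, hp, φ, ψ, hφ, hφψ⟩ := exists_torsion_divisible_by_two d hd hdvd
    have h := AddChar.card_le_pow_of_separates (zero_lt_one.trans hp)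
      (fun k => ((0 : Fin a → ZMod 2), φ k)) (fun k => by ext <;> simp [(hφψ k).1]) T
      (fun k l hkl => hφ (congrArg Prod.snd (hsep _ _ (fun χ hχ => ?_) hkl)))
    · rw [Fintype.card_fun, Fintype.card_fin, Fintype.card_fin] at h
      exact (Nat.pow_le_pow_iff_right hp).1 h
    · have hsq y : χ y ^ 2 = 1 := by
        have h1 : χ⁻¹ y = χ y := by rw [hR χ hχ]
        rw [AddChar.inv_apply, AddChar.map_neg_eq_inv] at h1
        have h0 := (χ.val_isUnit y).ne_zero
        rw [sq]
        nth_rewrite 1 [← h1]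
        exact inv_mul_cancel₀ h0
      have hone k : χ (0, φ k) = 1 := by
        rw [show ((0 : Fin a → ZMod 2), φ k) = 2 • (0, ψ k) by ext <;> simp [(hφψ k).2],
          AddChar.map_nsmul_eq_pow, hsq]
      rw [hone, hone]
  rcases Nat.eq_zero_or_pos a with rfl | ha
  · omega
  · have h2 := hdvd2 ha
    have h := AddChar.card_le_pow_of_separates two_pos
      (fun k : (Fin a → ZMod 2) × (Fin b → Fin 2) =>
        (k.1, fun i => ((k.2 i * (d i / 2) : ℕ) : ZMod (d i))))
      (fun k => Prod.ext (funext fun i => CharTwo.two_nsmul _)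
        (funext fun i => ZMod.nsmul_natCast_mul_div (h2 i) _)) (R ∪ T)
      (fun k l hkl => ?_)
    · rw [Fintype.card_prod, Fintype.card_fun, Fintype.card_fun, Fintype.card_fin, Fintype.card_fin,
        Fintype.card_fin, ZMod.card, ← pow_add] at h
      have h := (Nat.pow_le_pow_iff_right one_lt_two).1 h
      have := Finset.card_union_le R T
      omega
    · have h : (k.1, fun i => ((k.2 i * (d i / 2) : ℕ) : ZMod (d i))) =
          (l.1, fun i => ((l.2 i * (d i / 2) : ℕ) : ZMod (d i))) :=
        hsep _ _ (fun ψ hψ => hkl ψ (Finset.mem_union_left _ hψ))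
          (fun ψ hψ => hkl ψ (Finset.mem_union_right _ hψ))
      exact Prod.ext (Prod.mk.inj h).1 (funext fun i =>
        ZMod.injective_natCast_mul_div (NeZero.ne _) (h2 i) (congrFun (Prod.mk.inj h).2 i))

lemma exists_faithful_real {a b : ℕ} {d : Fin b → ℕ} [∀ i, NeZero (d i)] :
    ∃ ρ : Multiplicative ((Fin a → ZMod 2) × (∀ i : Fin b, ZMod (d i))) →*
      GL (Fin (a + 2 * b)) ℝ, Function.Injective ρ := by
  classical
  let s : AddChar (ZMod 2) ℝ := AddChar.zmodChar 2 (ζ := -1) (by norm_num)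
  have hs : Function.Injective s := by
    have h1 : s 1 = -1 := (AddChar.zmodChar_apply _ _).trans (pow_one _)
    have hcases : ∀ x : ZMod 2, x = 0 ∨ x = 1 := by decide
    intro x y h
    rcases hcases x with rfl | rfl <;> rcases hcases y with rfl | rfl <;>
      first | rfl | norm_num [h1] at h
  let f : Multiplicative ((Fin a → ZMod 2) × (∀ i : Fin b, ZMod (d i))) →*
      (Fin a → ℝ) × (Fin b → ℂ) :=
    { toFun := fun x => (fun i => s (x.toAdd.1 i), fun i => ZMod.stdAddChar (x.toAdd.2 i))
      map_one' := by ext <;> simp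
      map_mul' := fun x y => by ext <;> simp [AddChar.map_add_eq_mul] }
  have hf : Function.Injective f := fun x y h =>
    Multiplicative.toAdd.injective (Prod.ext
      (funext fun i => hs (congrFun (congrArg Prod.fst h) i))
      (funext fun i => ZMod.injective_stdAddChar (congrFun (congrArg Prod.snd h) i)))
  let B : Module.Basis (Fin (a + 2 * b)) ℝ ((Fin a → ℝ) × (Fin b → ℂ)) :=
    Module.finBasisOfFinrankEq _ _ (by simp [Module.finrank_pi_fintype, mul_comm])
  let g := (Algebra.leftMulMatrix B).toRingHom.toMonoidHom.comp f
  refine ⟨g.toHomUnits, fun x y h => hf (Algebra.leftMulMatrix_injective B ?_)⟩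
  exact congrArg Units.val h

/-- a finite abelian group with invariant factor decomposition
`A ≅ (Z/2Z)^a ⊕ Z_{d_{a+1}} ⊕ ... ⊕ Z_{d_{a+b}}`, where each `d_i > 2` and the divisibility
chain holds (in particular `2 ∣ d_i` whenever `a > 0`), has minimal faithful real
representation dimension exactly `a + 2b`. -/
theorem stmt12 (A : Type) [AddCommGroup A] [Fintype A] (a b : ℕ) (d : Fin b → ℕ)
    (hd : ∀ i, 2 < d i) (hdvd : ∀ i j : Fin b, i ≤ j → d i ∣ d j)
    (hdvd2 : 0 < a → ∀ i, 2 ∣ d i)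
    (hiso : Nonempty (A ≃+ ((Fin a → ZMod 2) × (∀ i : Fin b, ZMod (d i))))) :
    (∃ ρ : Multiplicative A →* Matrix.GeneralLinearGroup (Fin (a + 2 * b)) ℝ,
      Function.Injective ρ) ∧
    (∀ n : ℕ, ∀ ρ : Multiplicative A →* Matrix.GeneralLinearGroup (Fin n) ℝ,
      Function.Injective ρ → a + 2 * b ≤ n) := by
  obtain ⟨e⟩ := hiso
  have (i : Fin b) : NeZero (d i) := ⟨by have := hd i; omega⟩
  refine ⟨?_, fun n ρ hρ => ?_⟩
  · obtain ⟨ρ, hρ⟩ := exists_faithful_real (a := a) (d := d)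
    exact ⟨ρ.comp e.toMultiplicative.toMonoidHom, hρ.comp e.toMultiplicative.injective⟩
  · exact le_of_faithful_real hd hdvd hdvd2 (ρ.comp e.symm.toMultiplicative.toMonoidHom)
      (hρ.comp e.symm.toMultiplicative.injective)
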